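/- Let μ > 4π, let a ∈ (−μ/2, μ/2 − 2π), and let κ ∈ ℂ with κ ∉ ℤ. Define W'_μ := {(z₁,z₂,z₃) ∈ ℂ³ : z₂ ≠ 0, z₃ ≠ 0, |z₁ − exp(i·log|z₂z₃|²)| < 1, −μ < log|z₂|² < μ, −μ < log|z₃|² < μ}, the annulus 𝒜_a := {ζ ∈ ℂ : a < log|ζ|² < a + 2π}, and the disk Δ_a := {ζ ∈ ℂ : |ζ − e^{2ia}| < 1}. Then there is no function F : ℂ³ → ℂ holomorphic on the open set W'_μ ∪ (Δ_a × 𝒜_a × 𝒜_a) such that F(z) = E_κ(z) for all z ∈ W'_μ. -/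

import Mathlib

open Complex

/-- `log|z₂z₃|²` as a real number. -/
noncomputable def Lofz (z : ℂ × ℂ × ℂ) : ℝ :=
  Real.log (‖z.2.1 * z.2.2‖ ^ 2)

/-- The truncated worm `W'_μ`. -/
noncomputable def wormTrunc (μ : ℝ) : Set (ℂ × ℂ × ℂ) :=
  {z | z.2.1 ≠ 0 ∧ z.2.2 ≠ 0 ∧
    ‖z.1 - Complex.exp (Complex.I * (Lofz z : ℂ))‖ < 1 ∧
    -μ < Real.log (‖z.2.1‖ ^ 2) ∧ Real.log (‖z.2.1‖ ^ 2) < μ ∧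
    -μ < Real.log (‖z.2.2‖ ^ 2) ∧ Real.log (‖z.2.2‖ ^ 2) < μ}

/-- The holomorphic logarithm `ℓ`, defined via the principal branch `Log`. -/
noncomputable def ellfun (z : ℂ × ℂ × ℂ) : ℂ :=
  Complex.log (z.1 * Complex.exp (-(Complex.I * (Lofz z : ℂ)))) + Complex.I * (Lofz z : ℂ)

/-- The holomorphic power `E_κ = exp(κℓ)`. -/
noncomputable def Efun (κ : ℂ) (z : ℂ × ℂ × ℂ) : ℂ :=
  Complex.exp (κ * ellfun z)

/-- The annulus `𝒜_a = {ζ : a < log|ζ|² < a + 2π}`. -/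
noncomputable def annA (a : ℝ) : Set ℂ :=
  {ζ | ζ ≠ 0 ∧ a < Real.log (‖ζ‖ ^ 2) ∧ Real.log (‖ζ‖ ^ 2) < a + 2 * Real.pi}

/-- The disk `Δ_a = {ζ : |ζ − e^{2ia}| < 1}`. -/
noncomputable def diskD (a : ℝ) : Set ℂ :=
  {ζ | ‖ζ - Complex.exp (2 * Complex.I * (a : ℂ))‖ < 1}


lemma aux_log_exp (w : ℂ) : Real.log (‖Complex.exp w‖ ^ 2) = 2 * w.re := by
  rw [Complex.norm_exp, Real.log_pow, Real.log_exp]; norm_num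

lemma aux_Lofz (c w : ℂ) : Lofz (c, Complex.exp w, Complex.exp w) = 4 * w.re := by
  unfold Lofz
  simp only
  rw [← Complex.exp_add, aux_log_exp, Complex.add_re]; ring

/-- Membership in the worm and value of `Efun` when `4 Re w = 2a + x + 2πn`, `|x| < 1`. -/
lemma aux_worm (μ a : ℝ) (hμ : 4 * Real.pi < μ)
    (ha : a ∈ Set.Ioo (-μ / 2) (μ / 2 - 2 * Real.pi)) (κ w : ℂ)
    (h1 : a < 2 * w.re) (h2 : 2 * w.re < a + 2 * Real.pi) (x : ℝ) (n : ℤ) (hx : |x| < 1)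
    (hw : 4 * w.re = 2 * a + x + 2 * Real.pi * n) :
    (Complex.exp (2 * Complex.I * a), Complex.exp w, Complex.exp w) ∈ wormTrunc μ ∧
    Efun κ (Complex.exp (2 * Complex.I * a), Complex.exp w, Complex.exp w) =
      Complex.exp (κ * (2 * Complex.I * a + n * (2 * Real.pi * Complex.I))) := by
  have hpi := Real.pi_gt_three
  obtain ⟨ha1, ha2⟩ := ha
  have hx' := abs_lt.1 hx
  have hL : Complex.exp (Complex.I * ((4 * w.re : ℝ) : ℂ)) =
      Complex.exp (2 * Complex.I * a) * Complex.exp (Complex.I * x) := by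
    rw [hw, ← Complex.exp_add, Complex.exp_eq_exp_iff_exists_int]
    refine ⟨n, ?_⟩
    push_cast; ring
  have hc : ‖Complex.exp (2 * Complex.I * a)‖ = 1 := by
    rw [Complex.norm_exp]; simp
  constructor
  · refine ⟨Complex.exp_ne_zero _, Complex.exp_ne_zero _, ?_, ?_, ?_, ?_, ?_⟩
    · rw [aux_Lofz, hL]
      simp only
      rw [show ∀ c e : ℂ, c - c * e = -(c * (e - 1)) by intros; ring, norm_neg, norm_mul, hc,
        one_mul]
      exact lt_of_le_of_lt (Real.norm_exp_I_mul_ofReal_sub_one_le) (by simpa using hx)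
    all_goals simp only [aux_log_exp]; linarith
  · unfold Efun ellfun
    rw [aux_Lofz, Complex.exp_neg, hL]
    simp only
    have h3 : Complex.exp (2 * Complex.I * a) *
        (Complex.exp (2 * Complex.I * a) * Complex.exp (Complex.I * x))⁻¹ =
        Complex.exp (-(Complex.I * x)) := by
      rw [Complex.exp_neg]
      field_simp [Complex.exp_ne_zero]
    rw [h3, Complex.log_exp (by simp; linarith) (by simp; linarith), hw]
    congr 2
    push_cast; ring

/-- For `κ ∉ ℤ`, the function `E_κ` admits no holomorphic extension from `W'_μ` to
`W'_μ ∪ (Δ_a × 𝒜_a × 𝒜_a)`, for any `a ∈ (−μ/2, μ/2 − 2π)` (with `μ > 4π`). -/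
theorem Efun_no_extension (μ : ℝ) (hμ : 4 * Real.pi < μ) (a : ℝ)
    (ha : a ∈ Set.Ioo (-μ / 2) (μ / 2 - 2 * Real.pi))
    (κ : ℂ) (hκ : ∀ n : ℤ, κ ≠ (n : ℂ)) :
    ¬ ∃ F : ℂ × ℂ × ℂ → ℂ,
        DifferentiableOn ℂ F (wormTrunc μ ∪ (diskD a ×ˢ annA a ×ˢ annA a)) ∧
        ∀ z ∈ wormTrunc μ, F z = Efun κ z := by
  rintro ⟨F, hF, hFE⟩
  have hpi := Real.pi_gt_three
  set c : ℂ := Complex.exp (2 * Complex.I * a) with hc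
  set S : Set ℂ := Complex.re ⁻¹' Set.Ioo (a / 2) (a / 2 + Real.pi) with hS
  have hSo : IsOpen S := isOpen_Ioo.preimage Complex.continuous_re
  have hSc : Convex ℝ S := (convex_Ioo _ _).linear_preimage Complex.reLm
  have hg : DifferentiableOn ℂ (fun w : ℂ => F (c, Complex.exp w, Complex.exp w)) S := by
    refine hF.comp (t := wormTrunc μ ∪ (diskD a ×ˢ annA a ×ˢ annA a))
      (f := fun w : ℂ => (c, Complex.exp w, Complex.exp w)) (by fun_prop) ?_
    rintro w ⟨hw1, hw2⟩
    have hA : Complex.exp w ∈ annA a :=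
      ⟨Complex.exp_ne_zero _, by rw [aux_log_exp]; linarith, by rw [aux_log_exp]; linarith⟩
    exact Or.inr ⟨by simp [diskD, hc], hA, hA⟩
  have han := hg.analyticOnNhd hSo
  set K : ℂ := Complex.exp (κ * (2 * Complex.I * a)) with hK
  have hw0 : (((a / 2 + 1 / 8 : ℝ) : ℂ)) ∈ S := by
    constructor <;> simp <;> linarith
  have hev : (fun w : ℂ => F (c, Complex.exp w, Complex.exp w)) =ᶠ[nhds ((a / 2 + 1 / 8 : ℝ) : ℂ)]
      fun _ => K := by
    have hU : Complex.re ⁻¹' Set.Ioo (a / 2) (a / 2 + 1 / 4) ∈ nhds ((a / 2 + 1 / 8 : ℝ) : ℂ) := by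
      refine (isOpen_Ioo.preimage Complex.continuous_re).mem_nhds ?_
      constructor <;> simp only [Complex.ofReal_re] <;> linarith
    filter_upwards [hU] with w hw
    obtain ⟨hw1, hw2⟩ := hw
    obtain ⟨m, e⟩ := aux_worm μ a hμ ha κ w (by linarith) (by linarith) (4 * w.re - 2 * a) 0
      (by rw [abs_lt]; constructor <;> linarith) (by simp)
    rw [hFE _ m, e, hK]
    simp
  have heq := han.eqOn_of_preconnected_of_eventuallyEq analyticOnNhd_const
    hSc.isPreconnected hw0 hev
  have hw1 : (((a / 2 + Real.pi / 2 : ℝ) : ℂ)) ∈ S := by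
    constructor <;> simp only [Complex.ofReal_re] <;> linarith
  have h := heq hw1
  obtain ⟨m, e⟩ := aux_worm μ a hμ ha κ ((a / 2 + Real.pi / 2 : ℝ) : ℂ)
    (by simp only [Complex.ofReal_re]; linarith) (by simp only [Complex.ofReal_re]; linarith) 0 1
    (by simp) (by simp only [Complex.ofReal_re]; push_cast; ring)
  simp only at h
  rw [hFE _ m, e, hK, Complex.exp_eq_exp_iff_exists_int] at h
  obtain ⟨n, hn⟩ := h
  refine hκ n ?_
  have h2 : κ * (2 * Real.pi * Complex.I) = n * (2 * Real.pi * Complex.I) := by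
    push_cast at hn
    linear_combination hn
  exact mul_right_cancel₀ Complex.two_pi_I_ne_zero h2
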